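/- Let {x_k}_{k=1}^∞ be a frame for the real Hilbert space ℓ₂. The following are equivalent: (1) {x_k}_{k=1}^∞ is injective; (2) the closed linear span of {x̃_k}_{k=1}^∞ equals H̃. -/

import Mathlib

open scoped InnerProductSpace

/-- The real Hilbert space `ℓ₂`. -/
abbrev ell2 : Type := lp (fun _ : ℕ => ℝ) 2

/-- `H̃`, the `ℓ₂` direct sum of countably many copies of the real `ℓ₂`. -/
abbrev Htilde : Type := lp (fun _ : ℕ => ell2) 2

/-- `T` is a Hilbert–Schmidt operator on `ℓ₂`: `Σ_i ‖T e_i‖² < ∞` for the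
canonical orthonormal basis `{e_i}`. -/
def IsHilbertSchmidt (T : ell2 →L[ℝ] ell2) : Prop :=
  Summable fun i : ℕ => ‖T (lp.single 2 i (1 : ℝ))‖ ^ 2

namespace Aux15

noncomputable section

lemma sq_norm_hasSum (v : ell2) : HasSum (fun i => (v i) ^ 2) (‖v‖ ^ 2) := by
  have h := lp.hasSum_inner (𝕜 := ℝ) v v
  rw [real_inner_self_eq_norm_sq] at h
  have hf : ∀ f g : ℕ → ℝ, ∀ a, HasSum f a → (∀ i, g i = f i) → HasSum g a := by
    intro f g a h1 h2
    rwa [funext h2]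
  refine hf _ _ _ h fun i => ?_
  simp [pow_two]

lemma sq_norm_hasSum' (v : Htilde) : HasSum (fun i => ‖v i‖ ^ 2) (‖v‖ ^ 2) := by
  have h := lp.hasSum_inner (𝕜 := ℝ) v v
  rw [real_inner_self_eq_norm_sq] at h
  have hf : ∀ f g : ℕ → ℝ, ∀ a, HasSum f a → (∀ i, g i = f i) → HasSum g a := by
    intro f g a h1 h2
    rwa [funext h2]
  refine hf _ _ _ h fun i => ?_
  rw [real_inner_self_eq_norm_sq]

lemma mem2 {E : ℕ → Type} [∀ i, NormedAddCommGroup (E i)] (f : ∀ i, E i)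
    (h : Summable fun i => ‖f i‖ ^ 2) : Memℓp f 2 := by
  apply memℓp_gen
  convert h using 2 with i
  simp

def e (i : ℕ) : ell2 := lp.single 2 i (1 : ℝ)

lemma e_apply (i j : ℕ) : e i j = if j = i then 1 else 0 := by
  simp [e, Pi.single_apply]

lemma inner_e (i : ℕ) (v : ell2) : ⟪e i, v⟫_ℝ = v i := by
  simp [e, lp.inner_single_left]

lemma norm_e (i : ℕ) : ‖e i‖ = 1 := by
  have h := real_inner_self_eq_norm_sq (e i)
  rw [inner_e, e_apply] at h
  simp at h
  nlinarith [norm_nonneg (e i)]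

def sh (i : ℕ) (v : ell2) : ell2 :=
  ⟨fun j => v (i + j), mem2 _ (by
    have := (sq_norm_hasSum v).summable.comp_injective (add_right_injective i)
    simpa [Function.comp_def] using this)⟩

@[simp] lemma sh_apply (i j : ℕ) (v : ell2) : sh i v j = v (i + j) := rfl

lemma norm_sh (i : ℕ) (v : ell2) : ‖sh i v‖ ≤ ‖v‖ := by
  have h1 := sq_norm_hasSum v
  have h2 := sq_norm_hasSum (sh i v)
  have : ‖sh i v‖ ^ 2 ≤ ‖v‖ ^ 2 := by
    rw [← h1.tsum_eq, ← h2.tsum_eq]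
    exact tsum_comp_le_tsum_of_inj h1.summable (fun _ => sq_nonneg _) (add_right_injective i)
  exact (sq_le_sq₀ (norm_nonneg _) (norm_nonneg _)).1 this

def til (v : ell2) : Htilde :=
  ⟨fun i => v i • sh i v, mem2 _ (by
    refine Summable.of_nonneg_of_le (fun _ => sq_nonneg _) (fun i => ?_)
      ((sq_norm_hasSum v).summable.mul_right (‖v‖ ^ 2))
    rw [norm_smul, mul_pow, Real.norm_eq_abs, sq_abs]
    gcongr
    exact norm_sh i v)⟩

lemma til_apply' (v : ell2) (i : ℕ) : til v i = v i • sh i v := rfl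

lemma til_apply (v : ell2) (i j : ℕ) : til v i j = v i * v (i + j) := rfl

lemma Sbound (b : Htilde) (v : ell2) (i : ℕ) :
    (⟪b i, sh i v⟫_ℝ) ^ 2 ≤ ‖b i‖ ^ 2 * ‖v‖ ^ 2 := by
  rw [← sq_abs, ← mul_pow]
  gcongr
  exact (abs_real_inner_le_norm _ _).trans (by gcongr; exact norm_sh i v)

def S0 (b : Htilde) (v : ell2) : ell2 :=
  ⟨fun i => ⟪b i, sh i v⟫_ℝ, mem2 _ (by
    refine Summable.of_nonneg_of_le (fun _ => sq_nonneg _) (fun i => ?_)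
      ((sq_norm_hasSum' b).summable.mul_right (‖v‖ ^ 2))
    rw [Real.norm_eq_abs, sq_abs]
    exact Sbound b v i)⟩

lemma S0_apply (b : Htilde) (v : ell2) (i : ℕ) : S0 b v i = ⟪b i, sh i v⟫_ℝ := rfl

lemma sh_add (i : ℕ) (v w : ell2) : sh i (v + w) = sh i v + sh i w := by
  ext j; rfl

lemma sh_smul (i : ℕ) (c : ℝ) (v : ell2) : sh i (c • v) = c • sh i v := by
  ext j; rfl

def S (b : Htilde) : ell2 →L[ℝ] ell2 :=
  LinearMap.mkContinuous
    { toFun := S0 b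
      map_add' := fun v w => by
        ext i
        simp only [S0_apply, sh_add, inner_add_right, lp.coeFn_add, Pi.add_apply]
      map_smul' := fun c v => by
        ext i
        simp only [S0_apply, sh_smul, inner_smul_right, lp.coeFn_smul, Pi.smul_apply,
          RingHom.id_apply, smul_eq_mul] } ‖b‖ (fun v => by
    have h1 := sq_norm_hasSum (S0 b v)
    have h2 := (sq_norm_hasSum' b).mul_right (‖v‖ ^ 2)
    have := hasSum_le (fun i => Sbound b v i) h1 h2
    rw [← mul_pow] at this
    exact (sq_le_sq₀ (norm_nonneg _) (by positivity)).1 this)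

lemma S_apply (b : Htilde) (v : ell2) (i : ℕ) : S b v i = ⟪b i, sh i v⟫_ℝ := rfl

lemma inner_S (b : Htilde) (v : ell2) : ⟪S b v, v⟫_ℝ = ⟪b, til v⟫_ℝ := by
  rw [lp.inner_eq_tsum, lp.inner_eq_tsum]
  congr 1
  ext i
  rw [S_apply, til_apply', inner_smul_right]
  simp

lemma S_e (b : Htilde) (i k : ℕ) : S b (e k) i = if i ≤ k then b i (k - i) else 0 := by
  rw [S_apply]
  split_ifs with h
  · have : sh i (e k) = e (k - i) := by
      ext j
      rw [sh_apply, e_apply, e_apply]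
      congr 1
      apply propext
      omega
    rw [this, real_inner_comm, inner_e]
  · have : sh i (e k) = 0 := by
      ext j
      rw [sh_apply, e_apply, if_neg (by omega)]
      rfl
    rw [this, inner_zero_right]

open ContinuousLinearMap in
lemma adj_apply (A : ell2 →L[ℝ] ell2) (i k : ℕ) : (adjoint A) (e i) k = A (e k) i := by
  rw [← inner_e, adjoint_inner_right, real_inner_comm, inner_e]

open ContinuousLinearMap in
lemma eq_zero (A : ell2 →L[ℝ] ell2) (h : ∀ i k, A (e k) i = 0) : A = 0 := by
  ext v i
  have h1 : (adjoint A) (e i) = 0 := by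
    ext k
    rw [adj_apply, h]
    rfl
  rw [← inner_e, ← adjoint_inner_left, h1, inner_zero_left]
  rfl

open ContinuousLinearMap in
lemma HS_adj (A : ell2 →L[ℝ] ell2) (h : Summable fun i => ‖A (e i)‖ ^ 2) :
    Summable fun i => ‖(adjoint A) (e i)‖ ^ 2 := by
  have h1 : Summable fun p : ℕ × ℕ => (A (e p.1) p.2) ^ 2 := by
    rw [summable_prod_of_nonneg (fun _ => sq_nonneg _)]
    refine ⟨fun i => (sq_norm_hasSum (A (e i))).summable, ?_⟩
    simpa only [(sq_norm_hasSum (A (e _))).tsum_eq] using h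
  have h2 := h1.prod_symm
  have h3 := ((summable_prod_of_nonneg (fun _ => sq_nonneg _)).1 h2).2
  refine h3.congr fun i => ?_
  rw [← (sq_norm_hasSum ((adjoint A) (e i))).tsum_eq]
  simp only [adj_apply, Prod.swap]

open ContinuousLinearMap in
lemma HS_Sadj (b : Htilde) : Summable fun i => ‖(adjoint (S b)) (e i)‖ ^ 2 := by
  refine Summable.of_nonneg_of_le (fun _ => sq_nonneg _) (fun i => ?_)
      (sq_norm_hasSum' b).summable
  set w := (adjoint (S b)) (e i) with hw
  have h1 : ‖w‖ ^ 2 = ⟪b i, sh i w⟫_ℝ := by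
    rw [← real_inner_self_eq_norm_sq]
    nth_rewrite 1 [hw]
    rw [adjoint_inner_left, inner_e, S_apply]
  have h2 := Sbound b w i
  rw [← h1] at h2
  by_cases h0 : ‖w‖ = 0
  · rw [h0, zero_pow two_ne_zero]; exact sq_nonneg _
  · have : 0 < ‖w‖ ^ 2 := by positivity
    rw [pow_two (‖w‖ ^ 2)] at h2
    exact le_of_mul_le_mul_right h2 this

open ContinuousLinearMap in
lemma HS_S (b : Htilde) : Summable fun i => ‖S b (e i)‖ ^ 2 := by
  have := HS_adj _ (HS_Sadj b)
  rwa [adjoint_adjoint] at this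

open ContinuousLinearMap in
lemma HS_T (b : Htilde) : Summable fun i => ‖(S b + adjoint (S b)) (e i)‖ ^ 2 := by
  refine Summable.of_nonneg_of_le (fun _ => sq_nonneg _) (fun i => ?_)
    (((HS_S b).add (HS_Sadj b)).mul_left 2)
  rw [add_apply]
  have h := norm_add_le (S b (e i)) ((adjoint (S b)) (e i))
  have h0 := norm_nonneg (S b (e i) + (adjoint (S b)) (e i))
  nlinarith [sq_nonneg (‖S b (e i)‖ - ‖(adjoint (S b)) (e i)‖)]

open ContinuousLinearMap in
lemma inner_T (b : Htilde) (v : ell2) :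
    ⟪(S b + adjoint (S b)) v, v⟫_ℝ = 2 * ⟪b, til v⟫_ℝ := by
  rw [add_apply, inner_add_left, adjoint_inner_left, real_inner_comm (S b v) v, inner_S]
  ring

open ContinuousLinearMap in
lemma T_entry (b : Htilde) (i k : ℕ) : (S b + adjoint (S b)) (e k) i =
    (if i ≤ k then b i (k - i) else 0) + (if k ≤ i then b k (i - k) else 0) := by
  rw [add_apply, lp.coeFn_add, Pi.add_apply, adj_apply, S_e, S_e]

def bT0 (T : ell2 →L[ℝ] ell2) (i : ℕ) : ell2 :=
  (2 : ℝ) • sh i (T (e i)) - (T (e i) i) • e 0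

lemma bT0_apply (T : ell2 →L[ℝ] ell2) (i j : ℕ) :
    bT0 T i j = 2 * T (e i) (i + j) - T (e i) i * (if j = 0 then 1 else 0) := by
  rw [← e_apply]; rfl

lemma norm_bT0 (T : ell2 →L[ℝ] ell2) (i : ℕ) : ‖bT0 T i‖ ≤ 3 * ‖T (e i)‖ := by
  have h1 : ‖(2 : ℝ) • sh i (T (e i))‖ ≤ 2 * ‖T (e i)‖ := by
    rw [norm_smul, Real.norm_eq_abs, abs_two]
    gcongr
    exact norm_sh _ _
  have h2 : ‖(T (e i) i) • e 0‖ ≤ ‖T (e i)‖ := by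
    rw [norm_smul, norm_e, mul_one]
    exact lp.norm_apply_le_norm (by simp) _ _
  have := norm_sub_le ((2 : ℝ) • sh i (T (e i))) ((T (e i) i) • e 0)
  unfold bT0
  linarith

def bT (T : ell2 →L[ℝ] ell2) (h : Summable fun i => ‖T (e i)‖ ^ 2) : Htilde :=
  ⟨bT0 T, mem2 _ (by
    refine Summable.of_nonneg_of_le (fun _ => sq_nonneg _) (fun i => ?_) (h.mul_left (3 ^ 2))
    rw [← mul_pow]
    gcongr
    exact norm_bT0 T i)⟩

lemma bT_apply (T : ell2 →L[ℝ] ell2) (h : Summable fun i => ‖T (e i)‖ ^ 2) (i j : ℕ) :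
    bT T h i j = 2 * T (e i) (i + j) - T (e i) i * (if j = 0 then 1 else 0) :=
  bT0_apply T i j

open ContinuousLinearMap in
lemma bT_eq (T : ell2 →L[ℝ] ell2) (h : Summable fun i => ‖T (e i)‖ ^ 2)
    (hs : IsSelfAdjoint T) : S (bT T h) + adjoint (S (bT T h)) = (2 : ℝ) • T := by
  rw [← sub_eq_zero]
  apply eq_zero
  intro i k
  have hsym : T (e k) i = T (e i) k := by
    rw [← adj_apply, hs.adjoint_eq]
  rw [sub_apply, lp.coeFn_sub, Pi.sub_apply, T_entry, smul_apply, lp.coeFn_smul, Pi.smul_apply,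
    smul_eq_mul]
  rcases lt_trichotomy i k with hik | rfl | hik
  · rw [if_pos hik.le, if_neg (by omega), bT_apply, if_neg (by omega),
      Nat.add_sub_cancel' hik.le, hsym]
    ring
  · simp only [le_refl, if_true, bT_apply, Nat.sub_self, add_zero]
    ring
  · rw [if_neg (by omega), if_pos hik.le, bT_apply, if_neg (by omega),
      Nat.add_sub_cancel' hik.le]
    ring

end

end Aux15

/-- A frame `{x_k}_{k=1}^∞` for the real `ℓ₂` is injective if and
only if the closed linear span of `{x̃_k}_{k=1}^∞` equals `H̃`, where
`x̃ = (v⃗_1, v⃗_2, …)` with `v⃗_i = (x_i x_i, x_i x_{i+1}, …)`. -/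
theorem stmt_15 (x : ℕ → ell2)
    (hframe : ∃ A B : ℝ, 0 < A ∧ A ≤ B ∧ ∀ v : ell2,
      A * ‖v‖ ^ 2 ≤ ∑' k, ⟪v, x k⟫_ℝ ^ 2 ∧ ∑' k, ⟪v, x k⟫_ℝ ^ 2 ≤ B * ‖v‖ ^ 2) :
    ((∀ T : ell2 →L[ℝ] ell2, IsHilbertSchmidt T → IsSelfAdjoint T →
        (∀ k, ⟪T (x k), x k⟫_ℝ = 0) → T = 0) ↔
      (Submodule.span ℝ {a : Htilde |
          ∃ k, ∀ i j, a i j = x k i * x k (i + j)}).topologicalClosure = ⊤) := by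
  clear hframe
  have hset : {a : Htilde | ∃ k, ∀ i j, a i j = x k i * x k (i + j)} =
      Set.range fun k => Aux15.til (x k) := by
    ext a
    constructor
    · rintro ⟨k, hk⟩
      refine ⟨k, ?_⟩
      ext i j
      exact (hk i j).symm
    · rintro ⟨k, rfl⟩
      exact ⟨k, fun i j => rfl⟩
  rw [hset, Submodule.topologicalClosure_eq_top_iff, Submodule.eq_bot_iff]
  have hmem : ∀ b : Htilde, b ∈ (Submodule.span ℝ (Set.range fun k => Aux15.til (x k)))ᗮ ↔
      ∀ k, ⟪b, Aux15.til (x k)⟫_ℝ = 0 := by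
    intro b
    rw [Submodule.mem_orthogonal']
    constructor
    · intro h k
      exact h _ (Submodule.subset_span ⟨k, rfl⟩)
    · intro h u hu
      induction hu using Submodule.span_induction with
      | mem y hy => obtain ⟨k, rfl⟩ := hy; exact h k
      | zero => exact inner_zero_right _
      | add y z _ _ hy hz => rw [inner_add_right, hy, hz, add_zero]
      | smul c y _ hy => rw [inner_smul_right, hy, mul_zero]
  constructor
  · intro h b hb
    rw [hmem] at hb
    have hT := h (Aux15.S b + ContinuousLinearMap.adjoint (Aux15.S b)) (Aux15.HS_T b)
      (IsSelfAdjoint.add_star_self (Aux15.S b))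
      (fun k => by rw [Aux15.inner_T, hb k, mul_zero])
    ext i j
    have h2 := Aux15.T_entry b i (i + j)
    rw [hT] at h2
    have h3 : (0 : ℝ) = (if i ≤ i + j then b i (i + j - i) else 0) +
      (if i + j ≤ i then b (i + j) (i - (i + j)) else 0) := h2
    rw [if_pos (by omega), Nat.add_sub_cancel_left] at h3
    change b i j = 0
    by_cases hj : j = 0
    · subst hj
      simp only [add_zero, le_refl, if_true, Nat.sub_self] at h3
      linarith
    · rw [if_neg (by omega)] at h3
      linarith
  · intro h T hHS hs hk
    have hHS' : Summable fun i => ‖T (Aux15.e i)‖ ^ 2 := hHS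
    have hb := Aux15.bT_eq T hHS' hs
    have hb0 : Aux15.bT T hHS' = 0 := by
      apply h
      rw [hmem]
      intro k
      have h1 := Aux15.inner_T (Aux15.bT T hHS') (x k)
      rw [hb, ContinuousLinearMap.smul_apply, real_inner_smul_left, hk k] at h1
      linarith
    have hz : (2 : ℝ) • T = 0 := by
      rw [← hb]
      apply Aux15.eq_zero
      intro i k
      rw [Aux15.T_entry, hb0]
      simp
    simpa using hz
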